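/- arXiv:1508.03317 — 6 statements merged into one kernel-verified Lean document; each statement's English description precedes it below -/
import Mathlib

section
/- If the general polynomial equation of degree n is solvable in radicals, then there is a radical n-formula. -/
open MvPolynomial

/-- The general polynomial equation of degree `n` is *solvable in radicals*. -/
def SolvableInRadicals (n : ℕ) : Prop :=
  ∃ (s : ℕ) (k : Fin s → ℕ) (p : ∀ j : Fin (s + 1), MvPolynomial (Fin (n + (j : ℕ))) ℂ),
    ∀ (a : Fin n → ℂ) (x : ℂ),
      x ^ n + ∑ i : Fin n, a i * x ^ (i : ℕ) = 0 →
      ∃ f : Fin s → ℂ,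
        (∀ j : Fin s,
          f j ^ k j =
            MvPolynomial.eval
              (Fin.append a (fun i : Fin (j : ℕ) => f (Fin.castLE j.isLt.le i)))
              (p j.castSucc)) ∧
        x = MvPolynomial.eval (Fin.append a f) (p (Fin.last s))

/-- The values `σ_1(x), …, σ_n(x)` of the elementary symmetric polynomials at
`x = (x_1, …, x_n) ∈ ℂ^n`. -/
noncomputable def esymmVals (n : ℕ) (x : Fin n → ℂ) : Fin n → ℂ :=
  fun i => MvPolynomial.eval x (MvPolynomial.esymm (Fin n) ℂ ((i : ℕ) + 1))

/-- A *radical `n`-formula*: `s`, non-negative integers `k j`, polynomials `p j` with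
complex coefficients in `n + j` variables, and functions `f j : ℂ^n → ℂ` (not assumed
continuous) such that, as equalities of functions of `x ∈ ℂ^n`,
`(f j)^(k j) = p j (σ_1, …, σ_n, f 0, …, f (j-1))` and `x_1 = p s (σ, f)`. -/
def HasRadicalFormula (n : ℕ) : Prop :=
  ∃ (s : ℕ) (k : Fin s → ℕ) (p : ∀ j : Fin (s + 1), MvPolynomial (Fin (n + (j : ℕ))) ℂ)
    (f : Fin s → ((Fin n → ℂ) → ℂ)),
    ∀ x : Fin n → ℂ,
      (∀ j : Fin s,
        f j x ^ k j =
          MvPolynomial.eval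
            (Fin.append (esymmVals n x) (fun i : Fin (j : ℕ) => f (Fin.castLE j.isLt.le i) x))
            (p j.castSucc)) ∧
      (∀ hn : 0 < n, x ⟨0, hn⟩ =
        MvPolynomial.eval (Fin.append (esymmVals n x) (fun i : Fin s => f i x)) (p (Fin.last s)))

/-- Vieta's formula: each coordinate of `x` is a root of the monic polynomial of degree `n` whose
coefficient of degree `i` is `(-1) ^ (n - i) * σ_{n - i}(x)`. -/
theorem pow_add_sum_esymmVals_eq_zero (n : ℕ) (x : Fin n → ℂ) (m : Fin n) :
    x m ^ n + ∑ i : Fin n,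
      ((-1) ^ (n - (i : ℕ)) * esymmVals n x (Fin.rev i)) * x m ^ (i : ℕ) = 0 := by
  have key := congrArg (Polynomial.eval (x m))
    (Multiset.prod_X_sub_X_eq_sum_esymm (Finset.univ.val.map x))
  have hz : Polynomial.eval (x m)
      ((Finset.univ.val.map x).map fun t => Polynomial.X - Polynomial.C t).prod = 0 := by
    rw [Polynomial.eval_multiset_prod]
    apply Multiset.prod_eq_zero
    simp only [Multiset.mem_map]
    exact ⟨_, ⟨x m, ⟨m, Finset.mem_univ m, rfl⟩, rfl⟩, by simp⟩
  have hσ (j : ℕ) : (Finset.univ.val.map x).esymm j =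
      MvPolynomial.eval x (MvPolynomial.esymm (Fin n) ℂ j) := by
    rw [← MvPolynomial.aeval_esymm_eq_multiset_esymm (Fin n) ℂ, MvPolynomial.aeval_eq_eval]
  simp_rw [hσ] at key
  rw [hz, Polynomial.eval_finsetSum, Multiset.card_map, Finset.card_val, Finset.card_univ,
    Fintype.card_fin, Finset.sum_range_succ', ← Fin.sum_univ_eq_sum_range,
    ← Equiv.sum_comp Fin.revPerm] at key
  rw [key, add_comm]
  congr 1
  · refine Finset.sum_congr rfl fun i _ => ?_
    have hi : n - (i : ℕ) = n - ((i : ℕ) + 1) + 1 := by omega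
    have hi' : n - (n - ((i : ℕ) + 1) + 1) = i := by omega
    simp [esymmVals, hi', hi, mul_assoc]
  · simp

/-- Evaluating after the substitution that rescales and permutes the first `n` variables. -/
theorem eval_bind₁_append {n k : ℕ} (c : Fin n → ℂ) (e : Fin n → Fin n) (a : Fin n → ℂ)
    (b : Fin k → ℂ) (q : MvPolynomial (Fin (n + k)) ℂ) :
    MvPolynomial.eval (Fin.append a b)
      (bind₁ (Fin.append (fun i => C (c i) * X (Fin.castAdd k (e i)))
        (fun i => X (Fin.natAdd n i))) q) =
      MvPolynomial.eval (Fin.append (fun i => c i * a (e i)) b) q := by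
  rw [← MvPolynomial.aeval_eq_eval, ← MvPolynomial.aeval_eq_eval, aeval_bind₁]
  congr 2
  ext i
  refine Fin.addCases (fun i => ?_) (fun i => ?_) i <;> simp

/-- **Vieta Lemma**: if the general polynomial equation of degree `n` is solvable in
radicals, then there is a radical `n`-formula. -/
theorem vieta_lemma (n : ℕ) (h : SolvableInRadicals n) : HasRadicalFormula n := by
  rcases Nat.eq_zero_or_pos n with rfl | hn
  · exact ⟨0, Fin.elim0, fun _ => 0, Fin.elim0, fun x => ⟨fun j => j.elim0, fun hn => by omega⟩⟩
  obtain ⟨s, k, p, h⟩ := h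
  choose f hf hx using fun x : Fin n → ℂ =>
    h _ (x ⟨0, hn⟩) (pow_add_sum_esymmVals_eq_zero n x ⟨0, hn⟩)
  refine ⟨s, k, fun j => bind₁ (Fin.append
    (fun i => C ((-1) ^ (n - (i : ℕ))) * X (Fin.castAdd _ (Fin.rev i)))
    (fun i => X (Fin.natAdd n i))) (p j), fun j x => f x j, fun x => ⟨fun j => ?_, fun _ => ?_⟩⟩
  · exact (hf x j).trans (eval_bind₁_append _ _ _ _ _).symm
  · exact (hx x).trans (eval_bind₁_append _ _ _ _ _).symm
end

section
/- For each integer n ≥ 5 there do not exist a non-negative integer s, positive integers k_1,…,k_s, and polynomials f_1,…,f_s ∈ ℂ[x_1,…,x_n] such that for each j = 1,…,s the element f_j^{k_j} lies in the subfield of the field of rational functions ℂ(x_1,…,x_n) generated over ℂ by σ_1,…,σ_n and f_1,…,f_{j-1}, and x_1 lies in the subfield of ℂ(x_1,…,x_n) generated over ℂ by σ_1,…,σ_n and f_1,…,f_s. -/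
open MvPolynomial

/-- The field `ℂ(x_1, …, x_n)` of rational functions, realized as the fraction field of
`ℂ[x_1, …, x_n]`. -/
abbrev RatFuncField (n : ℕ) := FractionRing (MvPolynomial (Fin n) ℂ)

/-- The canonical inclusion `ℂ[x_1, …, x_n] → ℂ(x_1, …, x_n)`. -/
noncomputable def toRatFunc (n : ℕ) : MvPolynomial (Fin n) ℂ →+* RatFuncField n :=
  algebraMap (MvPolynomial (Fin n) ℂ) (RatFuncField n)

/-- The subfield of `ℂ(x_1, …, x_n)` generated over `ℂ` by `σ_1, …, σ_n` and the images of
the polynomials `g i`, `i : Fin m`. -/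
noncomputable def genSubfield (n m : ℕ) (g : Fin m → MvPolynomial (Fin n) ℂ) :
    Subfield (RatFuncField n) :=
  Subfield.closure
    ((Set.range fun c : ℂ => toRatFunc n (MvPolynomial.C c)) ∪
     (Set.range fun i : Fin n => toRatFunc n (MvPolynomial.esymm (Fin n) ℂ ((i : ℕ) + 1))) ∪
     (Set.range fun i : Fin m => toRatFunc n (g i)))

theorem exists_eq_C_mul_of_pow_eq_pow {ι : Type*} {k : ℕ} (hk : 0 < k)
    {p q : MvPolynomial ι ℂ} (h : p ^ k = q ^ k) : ∃ c : ℂ, p = C c * q := by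
  have : NeZero k := ⟨hk.ne'⟩
  have hζ : IsPrimitiveRoot (C (Complex.exp (2 * Real.pi * Complex.I / k)) : MvPolynomial ι ℂ) k :=
    (Complex.isPrimitiveRoot_exp k hk.ne').map_of_injective (C_injective ι ℂ)
  have hprod := hζ.pow_sub_pow_eq_prod_sub_mul p q hk
  rw [h, sub_self, eq_comm, Finset.prod_eq_zero_iff] at hprod
  obtain ⟨ξ, hξ, hpq⟩ := hprod
  obtain ⟨i, -, rfl⟩ :=
    hζ.eq_pow_of_pow_eq_one ((Polynomial.mem_nthRootsFinset hk (1 : MvPolynomial ι ℂ)).1 hξ)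
  exact ⟨_, by rw [C_pow]; exact sub_eq_zero.1 hpq⟩

/-- A polynomial one of whose powers is fixed by the alternating group is itself fixed by the
alternating group, because the latter is perfect on at least five letters. -/
theorem rename_eq_of_rename_pow_eq {ι : Type*} [Fintype ι] [DecidableEq ι]
    (hι : 5 ≤ Nat.card ι) {k : ℕ} (hk : 0 < k) {p : MvPolynomial ι ℂ}
    (h : ∀ σ ∈ alternatingGroup ι, rename σ (p ^ k) = p ^ k)
    {σ : Equiv.Perm ι} (hσ : σ ∈ alternatingGroup ι) : rename σ p = p := by
  rcases eq_or_ne p 0 with rfl | hp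
  · simp
  have hc : ∀ τ : alternatingGroup ι, ∃ c : ℂ, rename (τ : Equiv.Perm ι) p = C c * p :=
    fun τ => exists_eq_C_mul_of_pow_eq_pow hk (by rw [← map_pow, h τ τ.2])
  choose c hc using hc
  have hinj : ∀ {a b : ℂ}, (C a * p : MvPolynomial ι ℂ) = C b * p → a = b :=
    fun hab => C_injective ι ℂ (mul_right_cancel₀ hp hab)
  let χ : alternatingGroup ι →* ℂ :=
    { toFun := c
      map_one' := hinj (by rw [← hc]; simp)
      map_mul' := fun a b => hinj (by
        rw [← hc, Subgroup.coe_mul, Equiv.Perm.coe_mul, ← rename_rename, hc b, map_mul, rename_C,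
          hc a, C_mul]
        ring) }
  have hker := Abelianization.commutator_subset_ker χ.toHomUnits
  rw [commutator_alternatingGroup_eq_top hι] at hker
  have h1 : c ⟨σ, hσ⟩ = 1 :=
    congrArg Units.val (MonoidHom.mem_ker.1 (hker (Subgroup.mem_top (⟨σ, hσ⟩ : alternatingGroup ι))))
  have := hc ⟨σ, hσ⟩
  rwa [h1, C_1, one_mul] at this

theorem rename_eq_of_mem_genSubfield {n m : ℕ} {g : Fin m → MvPolynomial (Fin n) ℂ}
    {σ : Equiv.Perm (Fin n)} (hg : ∀ i, rename σ (g i) = g i) {p : MvPolynomial (Fin n) ℂ}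
    (hp : toRatFunc n p ∈ genSubfield n m g) : rename σ p = p := by
  let φ : RatFuncField n →+* RatFuncField n :=
    (IsFractionRing.ringEquivOfRingEquiv (renameEquiv ℂ σ).toRingEquiv :
      RatFuncField n ≃+* RatFuncField n)
  have hφ : ∀ q, φ (toRatFunc n q) = toRatFunc n (rename σ q) := fun q =>
    IsFractionRing.ringEquivOfRingEquiv_algebraMap (renameEquiv ℂ σ).toRingEquiv q
  have hle : genSubfield n m g ≤ φ.eqLocusField (RingHom.id _) := by
    refine Subfield.closure_le.2 ?_
    rintro _ ((⟨c, rfl⟩ | ⟨i, rfl⟩) | ⟨i, rfl⟩) <;>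
      simp only [SetLike.mem_coe, RingHom.mem_eqLocusField, RingHom.id_apply, hφ]
    · rw [rename_C]
    · rw [rename_esymm]
    · rw [hg]
  have := hle hp
  rw [RingHom.mem_eqLocusField, hφ] at this
  exact IsFractionRing.injective (MvPolynomial (Fin n) ℂ) (RatFuncField n) this

/-- **Rational Ruffini Theorem**: for each `n ≥ 5` there do not exist `s`, positive
integers `k 0, …, k (s-1)` and polynomials `f 0, …, f (s-1) ∈ ℂ[x_1, …, x_n]` such that
each `(f j)^(k j)` lies in the subfield of `ℂ(x_1, …, x_n)` generated over `ℂ` by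
`σ_1, …, σ_n, f 0, …, f (j-1)`, and `x_1` lies in the subfield generated over `ℂ` by
`σ_1, …, σ_n, f 0, …, f (s-1)`. -/
theorem ruffini_rational (n : ℕ) (hn : 5 ≤ n) :
    ¬ ∃ (s : ℕ) (k : Fin s → ℕ) (f : Fin s → MvPolynomial (Fin n) ℂ),
      (∀ j : Fin s, 0 < k j) ∧
      (∀ j : Fin s,
        toRatFunc n (f j ^ k j) ∈
          genSubfield n (j : ℕ) (fun i : Fin (j : ℕ) => f (Fin.castLE j.isLt.le i))) ∧
      toRatFunc n (MvPolynomial.X ⟨0, by omega⟩) ∈ genSubfield n s f := by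
  rintro ⟨s, k, f, hk, hf, hX⟩
  have hcard : 5 ≤ Nat.card (Fin n) := by simpa using hn
  have hfix : ∀ (j : ℕ) (hj : j < s), ∀ σ ∈ alternatingGroup (Fin n),
      rename σ (f ⟨j, hj⟩) = f ⟨j, hj⟩ := by
    intro j
    induction j using Nat.strong_induction_on with
    | _ j ih =>
      intro hj σ hσ
      exact rename_eq_of_rename_pow_eq hcard (hk ⟨j, hj⟩)
        (fun τ hτ => rename_eq_of_mem_genSubfield
          (fun i => ih i i.2 (i.2.trans hj) τ hτ) (hf ⟨j, hj⟩)) hσ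
  let a : Fin n := ⟨0, by omega⟩
  let b : Fin n := ⟨1, by omega⟩
  let c : Fin n := ⟨2, by omega⟩
  have hab : a ≠ b := by simp [a, b]
  have hbc : b ≠ c := by simp [b, c]
  have hσ : Equiv.swap a b * Equiv.swap b c ∈ alternatingGroup (Fin n) := by
    simp [Equiv.Perm.mem_alternatingGroup, Equiv.Perm.sign_swap hab, Equiv.Perm.sign_swap hbc]
  have hXa := rename_eq_of_mem_genSubfield (fun i => hfix i i.2 _ hσ) hX
  rw [rename_X] at hXa
  have h0 : (Equiv.swap a b * Equiv.swap b c) a = a := X_injective hXa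
  rw [Equiv.Perm.mul_apply, Equiv.swap_apply_of_ne_of_ne hab (by simp [a, c]),
    Equiv.swap_apply_left] at h0
  exact hab h0.symm
end

section
/- Let n ≥ 5 be an integer and let f ∈ ℂ[x_1,…,x_n] be a polynomial such that f^q is even-symmetric for some positive integer q. Then f is even-symmetric. -/
open MvPolynomial

/-- A polynomial `f ∈ ℂ[x_1, …, x_n]` is *even-symmetric* if
`f(x_1, …, x_n) = f(x_{α 1}, …, x_{α n})` for every even permutation `α`, i.e. `f` is
invariant under renaming the variables by any even permutation. -/
def EvenSymmetric {n : ℕ} (f : MvPolynomial (Fin n) ℂ) : Prop :=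
  ∀ α : Equiv.Perm (Fin n), Equiv.Perm.sign α = 1 → MvPolynomial.rename α f = f

open scoped commutatorElement

/-- Two polynomials over `ℂ` with equal `q`-th powers differ by a constant factor. -/
theorem MvPolynomial.exists_eq_C_mul_of_pow_eq {σ : Type*} {f g : MvPolynomial σ ℂ} {q : ℕ}
    (hq : 0 < q) (h : g ^ q = f ^ q) : ∃ c : ℂ, g = C c * f := by
  have hζ := (Complex.isPrimitiveRoot_exp q hq.ne').map_of_injective
    (MvPolynomial.C_injective σ ℂ)
  have hprod := hζ.pow_sub_pow_eq_prod_sub_mul g f hq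
  rw [h, sub_self, eq_comm, Finset.prod_eq_zero_iff] at hprod
  obtain ⟨z, hz, hzero⟩ := hprod
  have hunit : IsUnit z :=
    IsUnit.of_pow_eq_one ((Polynomial.mem_nthRootsFinset hq 1).mp hz) hq.ne'
  obtain ⟨c, -, rfl⟩ := MvPolynomial.isUnit_iff_eq_C_of_isReduced.mp hunit
  exact ⟨c, sub_eq_zero.mp hzero⟩

/-- If `f` is a common eigenvector of two permutations of the variables, then it is fixed by
their commutator. -/
theorem MvPolynomial.rename_commutatorElement_eq_self {σ R : Type*} [CommRing R] [IsDomain R]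
    {f : MvPolynomial σ R} {a b : Equiv.Perm σ} {c d : R}
    (ha : rename a f = C c * f) (hb : rename b f = C d * f) :
    rename (⁅a, b⁆ : Equiv.Perm σ) f = f := by
  by_cases hf : f = 0
  · simp [hf]
  have hab : rename (a * b : Equiv.Perm σ) f = C (c * d) * f := by
    rw [Equiv.Perm.coe_mul, ← rename_rename, hb, map_mul, rename_C, ha, map_mul]
    ring
  have hba : rename (b * a : Equiv.Perm σ) f = C (c * d) * f := by
    rw [Equiv.Perm.coe_mul, ← rename_rename, ha, map_mul, rename_C, hb, map_mul]
    ring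
  have hcd : (C (c * d) : MvPolynomial σ R) ≠ 0 := by
    intro h0
    rw [h0, zero_mul] at hab
    exact hf (rename_injective _ (a * b).injective (by rw [hab, map_zero]))
  have hcomm : ⁅a, b⁆ * (b * a) = a * b := by
    rw [commutatorElement_def]
    group
  apply mul_left_cancel₀ hcd
  rw [← hab, ← hcomm, Equiv.Perm.coe_mul, ← rename_rename, hba]
  simp only [map_mul, rename_C]

/-- **Keeping Symmetry Through Extraction of a Radical** (polynomial version):
for `n ≥ 5`, if `f^q` is even-symmetric for some positive integer `q`, then `f` is
even-symmetric. -/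
theorem evenSymmetric_of_pow_evenSymmetric (n : ℕ) (hn : 5 ≤ n)
    (f : MvPolynomial (Fin n) ℂ) (q : ℕ) (hq : 0 < q) (h : EvenSymmetric (f ^ q)) :
    EvenSymmetric f := by
  have heigen : ∀ α : Equiv.Perm (Fin n), Equiv.Perm.sign α = 1 →
      ∃ c : ℂ, rename α f = C c * f := fun α hα =>
    exists_eq_C_mul_of_pow_eq hq (by rw [← map_pow, h α hα])
  intro α hα
  rw [← Equiv.Perm.mem_alternatingGroup,
    ← commutator_alternatingGroup_eq_self (by simpa using hn), Subgroup.commutator_def] at hα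
  induction hα using Subgroup.closure_induction with
  | mem x hx =>
    obtain ⟨a, ha, b, hb, rfl⟩ := hx
    obtain ⟨c, hc⟩ := heigen a (Equiv.Perm.mem_alternatingGroup.mp ha)
    obtain ⟨d, hd⟩ := heigen b (Equiv.Perm.mem_alternatingGroup.mp hb)
    exact rename_commutatorElement_eq_self hc hd
  | one => rw [Equiv.Perm.coe_one, rename_id_apply]
  | mul x y _ _ hx hy => rw [Equiv.Perm.coe_mul, ← rename_rename, hy, hx]
  | inv x _ hx =>
    apply rename_injective _ x.injective
    rw [rename_rename, ← Equiv.Perm.coe_mul, mul_inv_cancel, Equiv.Perm.coe_one,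
      rename_id_apply, hx]
end

section
/- Let n ≥ 5 be an integer and let f ∈ ℂ(x_1,…,x_n) be a rational function such that f^q is even-symmetric for some positive integer q. Then f is even-symmetric. -/
open MvPolynomial

/-- The field automorphism of `ℂ(x_1, …, x_n)` induced by a permutation `α` of the
variables (sending `x_i` to `x_{α i}`). -/
noncomputable def permAut (n : ℕ) (α : Equiv.Perm (Fin n)) :
    RatFuncField n ≃+* RatFuncField n :=
  IsFractionRing.ringEquivOfRingEquiv
    ((MvPolynomial.renameEquiv ℂ α).toRingEquiv)

/-- A rational function `f ∈ ℂ(x_1, …, x_n)` is *even-symmetric* if it is invariant under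
the field automorphisms induced by even permutations of the variables. -/
def EvenSymmetricRat {n : ℕ} (f : RatFuncField n) : Prop :=
  ∀ α : Equiv.Perm (Fin n), Equiv.Perm.sign α = 1 → permAut n α f = f

theorem permAut_algebraMap {n : ℕ} (α : Equiv.Perm (Fin n)) (p : MvPolynomial (Fin n) ℂ) :
    permAut n α (algebraMap _ (RatFuncField n) p) =
      algebraMap _ (RatFuncField n) (rename α p) := by
  simp [permAut]

theorem permAut_mul_apply {n : ℕ} (α β : Equiv.Perm (Fin n)) (x : RatFuncField n) :
    permAut n (α * β) x = permAut n α (permAut n β x) := by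
  suffices (permAut n (α * β)).toRingHom =
      (permAut n α).toRingHom.comp (permAut n β).toRingHom from RingHom.congr_fun this x
  refine IsLocalization.ringHom_ext (nonZeroDivisors (MvPolynomial (Fin n) ℂ)) ?_
  refine RingHom.ext fun p => ?_
  change permAut n (α * β) (algebraMap _ _ p) = permAut n α (permAut n β (algebraMap _ _ p))
  simp only [permAut_algebraMap, rename_rename, Equiv.Perm.coe_mul]

theorem permAut_one_apply {n : ℕ} (x : RatFuncField n) : permAut n 1 x = x :=
  (permAut n 1).injective (by rw [← permAut_mul_apply, one_mul])

/-- Roots of unity in `ℂ(x_1, …, x_n)` are constants, hence fixed by all permutations. -/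
theorem permAut_eq_self_of_pow_eq_one {n q : ℕ} (hq : 0 < q) (α : Equiv.Perm (Fin n))
    {c : RatFuncField n} (hc : c ^ q = 1) : permAut n α c = c := by
  have : NeZero q := ⟨hq.ne'⟩
  have hζ := (Complex.isPrimitiveRoot_exp q hq.ne').map_of_injective
    (f := (algebraMap (MvPolynomial (Fin n) ℂ) (RatFuncField n)).comp C)
    ((IsFractionRing.injective (MvPolynomial (Fin n) ℂ) (RatFuncField n)).comp
      (C_injective (Fin n) ℂ))
  obtain ⟨i, -, rfl⟩ := hζ.eq_pow_of_pow_eq_one hc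
  rw [map_pow, RingHom.comp_apply, permAut_algebraMap, rename_C]

/-- The character of the alternating group describing its action on a nonzero `f`
some power of which is even-symmetric. -/
noncomputable def evenCharacter {n q : ℕ} (hq : 0 < q) {f : RatFuncField n} (hf : f ≠ 0)
    (h : EvenSymmetricRat (f ^ q)) : alternatingGroup (Fin n) →* RatFuncField n where
  toFun α := permAut n α f / f
  map_one' := by
    rw [Subgroup.coe_one, permAut_one_apply, div_self hf]
  map_mul' α β := by
    have hβ : (permAut n β f / f) ^ q = 1 := by
      rw [div_pow, ← map_pow, h β (Equiv.Perm.mem_alternatingGroup.mp β.2),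
        div_self (pow_ne_zero q hf)]
    have hfix := permAut_eq_self_of_pow_eq_one hq (α : Equiv.Perm (Fin n)) hβ
    have hα : permAut n α f ≠ 0 := (map_ne_zero_iff _ (permAut n α).injective).mpr hf
    rw [map_div₀, div_eq_iff hα] at hfix
    rw [Subgroup.coe_mul, permAut_mul_apply, hfix]
    ring

/-- **Keeping Symmetry Through Extraction of a Radical** (rational version):
for `n ≥ 5`, if `f^q` is even-symmetric for some positive integer `q`, then `f` is
even-symmetric. -/
theorem evenSymmetricRat_of_pow_evenSymmetricRat (n : ℕ) (hn : 5 ≤ n)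
    (f : RatFuncField n) (q : ℕ) (hq : 0 < q) (h : EvenSymmetricRat (f ^ q)) :
    EvenSymmetricRat f := by
  rcases eq_or_ne f 0 with rfl | hf
  · exact fun α _ => map_zero _
  intro α hα
  have hle := Abelianization.commutator_subset_ker (evenCharacter hq hf h).toHomUnits
  rw [commutator_alternatingGroup_eq_top (by simpa using hn)] at hle
  have hker := hle (Subgroup.mem_top ⟨α, Equiv.Perm.mem_alternatingGroup.mpr hα⟩)
  have hone : permAut n α f / f = 1 := congrArg Units.val (MonoidHom.mem_ker.mp hker)
  exact (div_eq_one_iff_eq hf).mp hone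
end

section
/- Let n and q be positive integers and let f ∈ ℂ[x_1,…,x_n] be a nonzero polynomial such that f^q is even-symmetric. Then for each even permutation α of {1,…,n} there is a unique complex q-th root of unity χ(α) such that f(x_1,…,x_n) = χ(α)·f(x_{α(1)},…,x_{α(n)}) as polynomials, and the resulting map χ satisfies χ(αβ) = χ(α)·χ(β) for all even permutations α, β. -/
open MvPolynomial

/-- In a domain over a field with a primitive `q`-th root of unity, two elements with the same
`q`-th power differ by a `q`-th root of unity from the base field. -/
theorem IsPrimitiveRoot.exists_eq_algebraMap_mul_of_pow_eq_pow {K A : Type*} [Field K] [CommRing A]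
    [IsDomain A] [Algebra K A] {q : ℕ} (hq : 0 < q) {ζ : K} (hζ : IsPrimitiveRoot ζ q) {a b : A}
    (h : a ^ q = b ^ q) : ∃ z : K, z ^ q = 1 ∧ a = algebraMap K A z * b := by
  have : NeZero q := ⟨hq.ne'⟩
  have hζA := hζ.map_of_injective (algebraMap K A).injective
  have hprod := hζA.pow_sub_pow_eq_prod_sub_mul a b hq
  rw [h, sub_self, eq_comm, Finset.prod_eq_zero_iff] at hprod
  obtain ⟨w, hw, hab⟩ := hprod
  obtain ⟨i, -, rfl⟩ := hζA.eq_pow_of_pow_eq_one ((Polynomial.mem_nthRootsFinset hq _).1 hw)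
  refine ⟨ζ ^ i, ?_, ?_⟩
  · rw [← pow_mul, mul_comm, pow_mul, hζ.pow_eq_one, one_pow]
  · rw [map_pow]
    exact sub_eq_zero.1 hab

/-- A nonzero polynomial determines the scalar relating it to one of its renamings. -/
theorem MvPolynomial.eq_of_eq_C_mul_rename {σ R : Type*} [CommRing R] [IsDomain R]
    {f : MvPolynomial σ R} (hf : f ≠ 0) (α : Equiv.Perm σ) {z w : R}
    (hz : f = C z * rename α f) (hw : f = C w * rename α f) : z = w := by
  have hren : rename α f ≠ 0 := fun h => hf (by rw [hz, h, mul_zero])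
  exact C_injective σ R (mul_right_cancel₀ hren (hz.symm.trans hw))

/-- If `f ∈ ℂ[x_1, …, x_n]` is a nonzero polynomial such that `f^q` is even-symmetric,
then for each even permutation `α` there is a unique complex `q`-th root of unity `χ α`
with `f(x_1, …, x_n) = χ α • f(x_{α 1}, …, x_{α n})` as polynomials, and the resulting
map `χ` carries composition to product. -/
theorem exists_char_of_pow_evenSymmetric (n q : ℕ) (hn : 0 < n) (hq : 0 < q)
    (f : MvPolynomial (Fin n) ℂ) (hf : f ≠ 0) (hsym : EvenSymmetric (f ^ q)) :
    ∃ χ : Equiv.Perm (Fin n) → ℂ,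
      (∀ α : Equiv.Perm (Fin n), Equiv.Perm.sign α = 1 →
        (χ α ^ q = 1 ∧ f = MvPolynomial.C (χ α) * MvPolynomial.rename α f ∧
          ∀ z : ℂ, z ^ q = 1 → f = MvPolynomial.C z * MvPolynomial.rename α f →
            z = χ α)) ∧
      (∀ α β : Equiv.Perm (Fin n), Equiv.Perm.sign α = 1 → Equiv.Perm.sign β = 1 →
        χ (α * β) = χ α * χ β) := by
  have hex (α : Equiv.Perm (Fin n)) (hα : Equiv.Perm.sign α = 1) :
      ∃ z : ℂ, z ^ q = 1 ∧ f = C z * rename α f :=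
    (Complex.isPrimitiveRoot_exp q hq.ne').exists_eq_algebraMap_mul_of_pow_eq_pow hq
      (by rw [← map_pow, hsym α hα])
  choose! χ hχ using hex
  refine ⟨χ, fun α hα => ⟨(hχ α hα).1, (hχ α hα).2, fun z _ hz =>
    eq_of_eq_C_mul_rename hf α hz (hχ α hα).2⟩, fun α β hα hβ => ?_⟩
  refine eq_of_eq_C_mul_rename hf (α * β) (hχ (α * β) (by simp [hα, hβ])).2 ?_
  calc
    f = C (χ α) * rename α f := (hχ α hα).2
    _ = C (χ α) * rename α (C (χ β) * rename β f) := by rw [← (hχ β hβ).2]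
    _ = C (χ α * χ β) * rename (α * β) f := by
      rw [map_mul, rename_C, rename_rename, ← mul_assoc, ← C_mul, Equiv.Perm.coe_mul]
end

section
/- Let n and k be positive integers and let f : ℂ^n → ℂ be a continuous function such that there exist polynomials p, r ∈ ℂ[x_1,…,x_n] with r ≠ 0 and r(z)·f(z)^k = p(z) for all z ∈ ℂ^n. Then f is a polynomial function, i.e., there is a polynomial g ∈ ℂ[x_1,…,x_n] with f(z) = g(z) for all z ∈ ℂ^n. -/
open MvPolynomial

/-- A continuous function whose `k`-th power has a derivative at `a` is itself differentiable at `a`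
provided that it does not vanish there. -/
theorem ContinuousAt.differentiableAt_of_pow {𝕜 : Type*} [NontriviallyNormedField 𝕜] [CharZero 𝕜]
    {f : 𝕜 → 𝕜} {a : 𝕜} {k : ℕ} (hk : k ≠ 0) (hf : ContinuousAt f a) (ha : f a ≠ 0)
    (hd : DifferentiableAt 𝕜 (fun z => f z ^ k) a) : DifferentiableAt 𝕜 f a := by
  let S : 𝕜 → 𝕜 := fun z => ∑ i ∈ Finset.range k, f z ^ i * f a ^ (k - 1 - i)
  have hS : ContinuousAt S a := by
    refine tendsto_finsetSum _ fun i _ => ?_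
    exact (hf.pow i).mul continuousAt_const
  have hSa : S a ≠ 0 := by
    have h1 : S a = k * f a ^ (k - 1) := by
      simp only [S]
      rw [Finset.sum_congr rfl (g := fun _ => f a ^ (k - 1))]
      · simp
      · intro i hi
        rw [← pow_add]
        congr 1
        have := Finset.mem_range.1 hi
        omega
    rw [h1]
    exact mul_ne_zero (Nat.cast_ne_zero.2 hk) (pow_ne_zero _ ha)
  have hlim := (hasDerivAt_iff_tendsto_slope.1 hd.hasDerivAt).div
    (hS.tendsto.mono_left nhdsWithin_le_nhds) hSa
  refine (hasDerivAt_iff_tendsto_slope.2 (hlim.congr' ?_)).differentiableAt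
  filter_upwards [(hS.eventually_ne hSa).filter_mono nhdsWithin_le_nhds] with z hz
  simp only [slope_def_field, Pi.div_apply]
  rw [← geom_sum₂_mul (f z) (f a) k]
  change S z * _ / _ / S z = _
  field_simp

/-- A continuous function on `ℂ` whose `k`-th power is a nonzero rational function is entire. -/
theorem Continuous.differentiable_of_polynomial_mul_pow_eq {k : ℕ} (hk : k ≠ 0) {f : ℂ → ℂ}
    (hf : Continuous f) {p r : Polynomial ℂ} (hp : p ≠ 0) (hr : r ≠ 0)
    (h : ∀ z, r.eval z * f z ^ k = p.eval z) : Differentiable ℂ f := by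
  intro c
  refine (Complex.analyticAt_of_differentiable_on_punctured_nhds_of_continuousAt ?_
    hf.continuousAt).differentiableAt
  have hpr : ∀ᶠ z in nhdsWithin c {c}ᶜ, (p * r).eval z ≠ 0 := by
    have hfin := Polynomial.finite_setOfPred_isRoot (mul_ne_zero hp hr)
    have : ((({z | (p * r).IsRoot z} : Set ℂ) \ {c})ᶜ) ∈ nhds c :=
      (hfin.subset Set.sdiff_subset).isClosed.isOpen_compl.mem_nhds (by simp)
    filter_upwards [nhdsWithin_le_nhds this, self_mem_nhdsWithin] with z hz hzc hz0
    exact hz ⟨hz0, hzc⟩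
  filter_upwards [hpr] with z hz
  rw [Polynomial.eval_mul] at hz
  have hpz := left_ne_zero_of_mul hz
  have hrz := right_ne_zero_of_mul hz
  refine hf.continuousAt.differentiableAt_of_pow hk (fun h0 => hpz ?_) ?_
  · rw [← h z, h0, zero_pow hk, mul_zero]
  · refine (p.differentiableAt.fun_div r.differentiableAt hrz).congr_of_eventuallyEq ?_
    filter_upwards [r.continuousAt.eventually_ne hrz] with w hw
    rw [← h w, mul_div_cancel_left₀ _ hw]

/-- A factor `z - a` may be cancelled in an equality of continuous functions on `ℂ`. -/
theorem Continuous.eq_of_sub_mul_eq {u v : ℂ → ℂ} (hu : Continuous u) (hv : Continuous v) (a : ℂ)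
    (h : ∀ z, (z - a) * u z = (z - a) * v z) : u = v :=
  Continuous.ext_on (dense_compl_singleton a) hu hv fun z hz =>
    mul_left_cancel₀ (sub_ne_zero.2 hz) (h z)

theorem exists_polynomial_of_polynomial_mul_pow_eq {k : ℕ} (hk : k ≠ 0) (m : ℕ) :
    ∀ {f : ℂ → ℂ}, Continuous f → ∀ {p r : Polynomial ℂ}, p ≠ 0 → r ≠ 0 → p.natDegree = m →
    (∀ z, r.eval z * f z ^ k = p.eval z) → ∃ q : Polynomial ℂ, ∀ z, f z = q.eval z := by
  induction m with
  | zero =>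
    intro f hf p r hp hr hm h
    obtain ⟨c, rfl⟩ := Polynomial.natDegree_eq_zero.1 hm
    have hc : c ≠ 0 := by simpa using hp
    have hrC : r.degree = 0 := by
      by_contra hdeg
      obtain ⟨b, hb⟩ := IsAlgClosed.exists_root r hdeg
      have := h b
      rw [hb.eq_zero, zero_mul, Polynomial.eval_C] at this
      exact hc this.symm
    obtain ⟨e, rfl⟩ : ∃ e, r = Polynomial.C e := ⟨_, Polynomial.eq_C_of_degree_eq_zero hrC⟩
    have he : e ≠ 0 := by simpa using hr
    have hdiff := hf.differentiable_of_polynomial_mul_pow_eq hk hp hr h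
    have hbdd : Bornology.IsBounded (Set.range f) := by
      refine (Metric.isBounded_closedBall (x := (0 : ℂ)) (r := max 1 ‖c / e‖)).subset ?_
      rintro _ ⟨z, rfl⟩
      rw [mem_closedBall_zero_iff]
      by_contra! hlt
      have h1 : f z ^ k = c / e := by
        rw [eq_div_iff he, mul_comm]
        simpa using h z
      have h2 : ‖f z‖ ≤ ‖f z‖ ^ k :=
        le_self_pow₀ ((le_max_left _ _).trans hlt.le) hk
      rw [← norm_pow, h1] at h2
      exact absurd ((le_max_right _ _).trans_lt hlt) (not_lt.2 h2)
    obtain ⟨b, hb⟩ := hdiff.exists_const_forall_eq_of_bounded hbdd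
    exact ⟨Polynomial.C b, fun z => by simp [hb z]⟩
  | succ m ih =>
    intro f hf p r hp hr hm h
    obtain ⟨a, ha⟩ := IsAlgClosed.exists_root p (by
      rw [Polynomial.degree_eq_natDegree hp, hm]
      exact_mod_cast Nat.succ_ne_zero m)
    obtain ⟨p', rfl⟩ := Polynomial.dvd_iff_isRoot.2 ha
    have hp' : p' ≠ 0 := right_ne_zero_of_mul hp
    have hm' : p'.natDegree = m := by
      rw [Polynomial.natDegree_mul (Polynomial.X_sub_C_ne_zero a) hp',
        Polynomial.natDegree_X_sub_C] at hm
      omega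
    by_cases hra : r.IsRoot a
    · obtain ⟨r', rfl⟩ := Polynomial.dvd_iff_isRoot.2 hra
      refine ih hf hp' (right_ne_zero_of_mul hr) hm' (congrFun ?_)
      refine Continuous.eq_of_sub_mul_eq (by fun_prop) (by fun_prop) a fun z => ?_
      simpa [mul_assoc] using h z
    · have hfa : f a = 0 := by
        have h1 := h a
        rw [ha.eq_zero] at h1
        exact (pow_eq_zero_iff hk).1 ((mul_eq_zero.1 h1).resolve_left hra)
      have hdiff := hf.differentiable_of_polynomial_mul_pow_eq hk hp hr h
      have hg : Continuous (dslope f a) := continuous_iff_continuousAt.2 fun z => by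
        rcases eq_or_ne z a with rfl | hz
        · exact continuousAt_dslope_same.2 (hdiff z)
        · exact (continuousAt_dslope_of_ne hz).2 hf.continuousAt
      have hfg : ∀ z, f z = (z - a) * dslope f a z := fun z => by
        simpa [hfa] using (sub_smul_dslope f a z).symm
      obtain ⟨q, hq⟩ := ih hg (r := r * (Polynomial.X - Polynomial.C a) ^ (k - 1)) hp'
        (mul_ne_zero hr (pow_ne_zero _ (Polynomial.X_sub_C_ne_zero a))) hm' (by
          refine congrFun (Continuous.eq_of_sub_mul_eq (by fun_prop) (by fun_prop) a fun z => ?_)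
          have h1 := h z
          obtain ⟨l, rfl⟩ := Nat.exists_eq_succ_of_ne_zero hk
          rw [hfg z] at h1
          simp only [Polynomial.eval_mul, Polynomial.eval_sub, Polynomial.eval_X,
            Polynomial.eval_C, Polynomial.eval_pow, Nat.succ_eq_add_one,
            Nat.add_sub_cancel] at h1 ⊢
          rw [← h1, mul_pow]
          ring)
      exact ⟨(Polynomial.X - Polynomial.C a) * q, fun z => by simp [hfg z, hq z]⟩

/-- A continuous function on `ℂ` whose `k`-th power is a rational function with numerator `p` is
a polynomial function of degree at most that of `p`. -/
theorem exists_polynomial_natDegree_le_of_polynomial_mul_pow_eq {k : ℕ} (hk : k ≠ 0) {f : ℂ → ℂ}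
    (hf : Continuous f) {p r : Polynomial ℂ} (hr : r ≠ 0)
    (h : ∀ z, r.eval z * f z ^ k = p.eval z) :
    ∃ q : Polynomial ℂ, q.natDegree ≤ p.natDegree ∧ ∀ z, f z = q.eval z := by
  rcases eq_or_ne p 0 with rfl | hp
  · refine ⟨0, le_rfl, fun z => ?_⟩
    have hdense : Dense {z | r.IsRoot z}ᶜ :=
      (Polynomial.finite_setOfPred_isRoot hr).countable.dense_compl ℂ
    have : f = fun _ => 0 := Continuous.ext_on hdense hf continuous_const fun z hz => by
      have h1 := h z
      rw [Polynomial.eval_zero] at h1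
      exact (pow_eq_zero_iff hk).1 ((mul_eq_zero.1 h1).resolve_left hz)
    simp [this]
  · obtain ⟨q, hq⟩ := exists_polynomial_of_polynomial_mul_pow_eq hk _ hf hp hr rfl h
    refine ⟨q, ?_, hq⟩
    have hrq : r * q ^ k = p := Polynomial.funext fun z => by
      rw [← h z, hq z, Polynomial.eval_mul, Polynomial.eval_pow]
    rw [← hrq, Polynomial.natDegree_mul hr (right_ne_zero_of_mul (hrq ▸ hp)),
      Polynomial.natDegree_pow]
    exact (Nat.le_mul_of_pos_left _ (Nat.pos_of_ne_zero hk)).trans (Nat.le_add_left _ _)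

/-- The complement of the zero set of a nonzero polynomial is dense in `ℂ^n`. -/
theorem MvPolynomial.dense_eval_ne_zero {σ : Type*} [Fintype σ] {p : MvPolynomial σ ℂ}
    (hp : p ≠ 0) : Dense {z : σ → ℂ | eval z p ≠ 0} := by
  refine Metric.dense_iff.2 fun z ε hε => ?_
  by_contra hne
  refine hp (funext_set (fun i => Metric.ball (z i) ε) (fun i => ?_) fun x hx => ?_)
  · exact infinite_of_mem_nhds (z i) (Metric.ball_mem_nhds _ hε)
  · rw [map_zero]
    by_contra hx0
    exact hne ⟨x, by rwa [ball_pi _ hε], hx0⟩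

theorem exists_mvPolynomial_of_mul_pow_eq {k : ℕ} (hk : k ≠ 0) (n : ℕ) :
    ∀ {f : (Fin n → ℂ) → ℂ}, Continuous f → ∀ {p r : MvPolynomial (Fin n) ℂ}, r ≠ 0 →
    (∀ z, eval z r * f z ^ k = eval z p) →
    ∃ g : MvPolynomial (Fin n) ℂ, ∀ z, f z = eval z g := by
  induction n with
  | zero =>
    intro f _ p r _ _
    exact ⟨C (f default), fun z => by rw [eval_C, Subsingleton.elim z default]⟩
  | succ n ih =>
    intro f hf p r hr h
    set P := finSuccEquiv ℂ n p with hP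
    set R := finSuccEquiv ℂ n r with hR
    have hR0 : R ≠ 0 := (map_ne_zero_iff _ (finSuccEquiv ℂ n).injective).2 hr
    have hcons : ∀ (x : ℂ) (y : Fin n → ℂ), (R.map (eval y)).eval x * f (Fin.cons x y) ^ k =
        (P.map (eval y)).eval x := fun x y => by
      rw [hR, hP, ← eval_eq_eval_mv_eval', ← eval_eq_eval_mv_eval', h]
    have hmap : ∀ (Q : Polynomial (MvPolynomial (Fin n) ℂ)) (x : ℂ) (y : Fin n → ℂ),
        eval y (Q.eval (C x)) = (Q.map (eval y)).eval x := fun Q x y => by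
      rw [Polynomial.eval_map, Polynomial.eval, Polynomial.hom_eval₂]
      simp
    have hinf : {x : ℂ | R.eval (C x) = 0}ᶜ.Infinite := by
      refine Set.Finite.infinite_compl ?_
      exact (Polynomial.finite_setOfPred_isRoot hR0).preimage (C_injective (Fin n) ℂ).injOn
    obtain ⟨s, hs, hcard⟩ := hinf.exists_subset_card_eq (P.natDegree + 1)
    have hnode : ∀ x ∈ s, ∃ g : MvPolynomial (Fin n) ℂ, ∀ y, f (Fin.cons x y) = eval y g := by
      intro x hx
      refine ih (p := P.eval (C x)) (r := R.eval (C x)) (hf.comp (by fun_prop)) (hs hx)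
        fun y => ?_
      rw [hmap, hmap, hcons]
    choose! g hg using hnode
    have hinterp : f = fun z =>
        eval z (∑ x ∈ s, rename Fin.succ (g x) *
          Polynomial.aeval (X 0) (Lagrange.basis s id x)) := by
      have hdense : Dense {z : Fin (n + 1) → ℂ | eval z (rename Fin.succ R.leadingCoeff) ≠ 0} :=
        dense_eval_ne_zero ((map_ne_zero_iff _ (rename_injective _ (Fin.succ_injective n))).2
          (Polynomial.leadingCoeff_ne_zero.2 hR0))
      refine Continuous.ext_on hdense hf (MvPolynomial.continuous_eval _) fun z hz => ?_
      obtain ⟨x, y, rfl⟩ : ∃ x y, z = Fin.cons x y := ⟨_, _, (Fin.cons_self_tail z).symm⟩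
      have hy : eval y R.leadingCoeff ≠ 0 := by
        simpa [eval_rename, Function.comp_def] using hz
      have hRy : R.map (eval y) ≠ 0 := fun h0 => hy (by
        simpa using congrArg (fun Q => Polynomial.coeff Q R.natDegree) h0)
      obtain ⟨q, hqdeg, hq⟩ := exists_polynomial_natDegree_le_of_polynomial_mul_pow_eq hk
        (f := fun x => f (Fin.cons x y)) (hf.comp (by fun_prop)) hRy fun x => hcons x y
      have hqlt : q.degree < s.card := by
        rw [hcard]
        refine Polynomial.degree_le_natDegree.trans_lt ?_
        exact_mod_cast Nat.lt_succ_of_le (hqdeg.trans Polynomial.natDegree_map_le)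
      have hqs := Lagrange.eq_interpolate (v := id) (Set.injOn_id _) hqlt
      rw [hq x, hqs, Lagrange.interpolate_apply, Polynomial.eval_finsetSum, map_sum]
      refine Finset.sum_congr rfl fun a ha => ?_
      have hbasis : eval (Fin.cons x y : Fin (n + 1) → ℂ)
          (Polynomial.aeval (X 0) (Lagrange.basis s id a)) =
          (Lagrange.basis s id a).eval x := by
        have hid : (eval (Fin.cons x y : Fin (n + 1) → ℂ)).comp (algebraMap ℂ _) = RingHom.id ℂ :=
          RingHom.ext fun c => by simp [algebraMap_eq]
        rw [Polynomial.aeval_def, Polynomial.hom_eval₂, hid, Polynomial.eval₂_id, eval_X,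
          Fin.cons_zero]
      rw [map_mul, hbasis, eval_rename, Polynomial.eval_mul, Polynomial.eval_C, id, ← hq a,
        hg a ha]
      rfl
    exact ⟨_, congrFun hinterp⟩

/-- A continuous function `f : ℂ^n → ℂ` whose `k`-th power is a rational function
(i.e. `r(z) · f(z)^k = p(z)` everywhere, for polynomials `p, r` with `r ≠ 0`)
is a polynomial function. -/
theorem continuous_radical_is_polynomial (n k : ℕ) (hn : 0 < n) (hk : 0 < k)
    (f : (Fin n → ℂ) → ℂ) (hf : Continuous f)
    (p r : MvPolynomial (Fin n) ℂ) (hr : r ≠ 0)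
    (h : ∀ z : Fin n → ℂ, MvPolynomial.eval z r * f z ^ k = MvPolynomial.eval z p) :
    ∃ g : MvPolynomial (Fin n) ℂ, ∀ z : Fin n → ℂ, f z = MvPolynomial.eval z g :=
  exists_mvPolynomial_of_mul_pow_eq hk.ne' n hf hr h
end
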